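/- Let |q| < 1, |ρ| < 1, x, y ∈ S(q), and let t, s ∈ ℝ satisfy |t|√(1-q) < 1 and |s|√(1-q) < 1. Then Σ_{n,m≥0} (t^n s^m / ([n]_q! [m]_q!)) Q_{n,m}(x,y|ρ,q) = (φ_H(x|t,q) φ_H(y|s,q) / γ_{0,0}(x,y|ρ,q)) · Σ_{k≥0} (ρ^k/[k]_q!) H_k(x|t,q) H_k(y|s,q), where H_k(·|·,q) denote the big q-Hermite polynomials. -/

import Mathlib

open Finset MeasureTheory

noncomputable section

/-- [n]_q = 1 + q + ... + q^{n-1} -/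
def qNat (q : ℝ) (n : ℕ) : ℝ := ∑ j ∈ Finset.range n, q ^ j

/-- [n]_q! -/
def qFact (q : ℝ) : ℕ → ℝ
  | 0 => 1
  | n + 1 => qFact q n * qNat q (n + 1)

/-- q-binomial coefficient -/
def qBinom (q : ℝ) (n k : ℕ) : ℝ :=
  if k ≤ n then qFact q n / (qFact q (n - k) * qFact q k) else 0

/-- q-Pochhammer symbol (a;q)_n -/
def qPoch (a q : ℝ) (n : ℕ) : ℝ := ∏ j ∈ Finset.range n, (1 - a * q ^ j)

/-- q-Pochhammer symbol (a;q)_∞ -/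
def qPochInf (a q : ℝ) : ℝ := ∏' j : ℕ, (1 - a * q ^ j)

/-- continuous q-Hermite polynomials H_n(x|q) -/
def qHermite (q : ℝ) : ℕ → ℝ → ℝ
  | 0, _ => 1
  | 1, x => x
  | n + 2, x => x * qHermite q (n + 1) x - qNat q (n + 1) * qHermite q n x

/-- big q-Hermite polynomials H_n(x|a,q) -/
def bigqHermite (q a : ℝ) : ℕ → ℝ → ℝ
  | 0, _ => 1
  | 1, x => x - a
  | n + 2, x => (x - a * q ^ (n + 1)) * bigqHermite q a (n + 1) x -
      qNat q (n + 1) * bigqHermite q a n x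

/-- rescaled Al-Salam--Chihara polynomials P_n(x|y,ρ,q) -/
def ascP (q y ρ : ℝ) : ℕ → ℝ → ℝ
  | 0, _ => 1
  | 1, x => x - ρ * y
  | n + 2, x => (x - ρ * y * q ^ (n + 1)) * ascP q y ρ (n + 1) x -
      qNat q (n + 1) * (1 - ρ ^ 2 * q ^ n) * ascP q y ρ n x

/-- generating function φ_H(x|t,q) of the q-Hermite polynomials -/
def phiH (q t x : ℝ) : ℝ := ∑' n : ℕ, t ^ n / qFact q n * qHermite q n x

/-- γ_{i,j}(x,y|ρ,q) -/
def gammaPM (q ρ : ℝ) (i j : ℕ) (x y : ℝ) : ℝ :=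
  ∑' n : ℕ, ρ ^ n / qFact q n * qHermite q (n + i) x * qHermite q (n + j) y

/-- the polynomials Q_{i,j}(x,y|ρ,q) -/
def Qpoly (q ρ : ℝ) (i j : ℕ) (x y : ℝ) : ℝ :=
  ∑ s ∈ Finset.range (j + 1),
    (-1 : ℝ) ^ s * q ^ (s * (s - 1) / 2) * qBinom q j s * ρ ^ s * qHermite q (j - s) y *
      ascP q y ρ (i + s) x / qPoch (ρ ^ 2) q (i + s)

/-- the interval S(q) = [-2/√(1-q), 2/√(1-q)] -/
def Sq (q : ℝ) : Set ℝ := Set.Icc (-(2 / Real.sqrt (1 - q))) (2 / Real.sqrt (1 - q))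

/-- ω(x,y|ρ) -/
def omegaPM (x y ρ : ℝ) : ℝ :=
  (1 - ρ ^ 2) ^ 2 - 4 * ρ * (1 + ρ ^ 2) * x * y + 4 * ρ ^ 2 * (x ^ 2 + y ^ 2)

/-- l(x|a) -/
def lPM (x a : ℝ) : ℝ := (1 + a) ^ 2 - 4 * a * x ^ 2

/-- the q-Normal density f_N(x|q) -/
def fN (q x : ℝ) : ℝ :=
  Real.sqrt ((1 - q) * (4 - (1 - q) * x ^ 2)) * qPochInf q q / (2 * Real.pi) *
    ∏' j : ℕ, lPM (x * Real.sqrt (1 - q) / 2) (q ^ (j + 1))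

/-- the (q,ρ)-Conditional Normal density f_CN(x|y,ρ,q) -/
def fCN (q ρ x y : ℝ) : ℝ :=
  fN q x * qPochInf (ρ ^ 2) q /
    ∏' j : ℕ, omegaPM (x * Real.sqrt (1 - q) / 2) (y * Real.sqrt (1 - q) / 2) (ρ * q ^ j)

/-- the (ρ,q)-bivariate Normal density f_{2D}(x,y|ρ,q) -/
def f2D (q ρ x y : ℝ) : ℝ := fCN q ρ x y * fN q y

section qIntegers

variable {q : ℝ}

lemma qNat_add (q : ℝ) (m n : ℕ) : qNat q (m + n) = qNat q m + q ^ m * qNat q n := by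
  simp only [qNat, Finset.sum_range_add, Finset.mul_sum, pow_add]

lemma one_sub_mul_qNat (q : ℝ) (n : ℕ) : (1 - q) * qNat q n = 1 - q ^ n :=
  mul_neg_geom_sum q n

lemma one_sub_pos_of_abs_lt_one (hq : |q| < 1) : 0 < 1 - q := by
  linarith [(abs_lt.mp hq).2]

lemma one_sub_pow_succ_pos (hq : |q| < 1) (n : ℕ) : 0 < 1 - q ^ (n + 1) :=
  one_sub_pos_of_abs_lt_one (by rw [abs_pow]; exact pow_lt_one₀ (abs_nonneg _) hq (by omega))

lemma qNat_succ_pos (hq : |q| < 1) (n : ℕ) : 0 < qNat q (n + 1) := by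
  have h := one_sub_pow_succ_pos hq n
  rw [← one_sub_mul_qNat] at h
  exact pos_of_mul_pos_right h (one_sub_pos_of_abs_lt_one hq).le

lemma qFact_pos (hq : |q| < 1) (n : ℕ) : 0 < qFact q n := by
  induction n with
  | zero => simp [qFact]
  | succ n ih => exact mul_pos ih (qNat_succ_pos hq n)

lemma qPoch_ne_zero {ρ : ℝ} (hq : |q| < 1) (hρ : |ρ| < 1) (n : ℕ) : qPoch (ρ ^ 2) q n ≠ 0 := by
  refine Finset.prod_ne_zero_iff.mpr fun j _ => (one_sub_pos_of_abs_lt_one ?_).ne'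
  rw [abs_mul, abs_pow, abs_pow]
  exact mul_lt_one_of_nonneg_of_lt_one_left (by positivity)
    (pow_lt_one₀ (abs_nonneg _) hρ two_ne_zero) (pow_le_one₀ (abs_nonneg _) hq.le)

/-- `[n]_q!` grows at least like `(1 - q)⁻ⁿ`. -/
lemma exists_inv_qFact_le (hq : |q| < 1) :
    ∃ B : ℝ, 0 < B ∧ ∀ n, (qFact q n)⁻¹ ≤ B * (1 - q) ^ n := by
  have h1 : 0 < 1 - |q| := by linarith
  have h1q := one_sub_pos_of_abs_lt_one hq
  have key : ∀ n, (qFact q n)⁻¹ ≤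
      Real.exp (∑ j ∈ Finset.range n, |q| ^ j / (1 - |q|)) * (1 - q) ^ n := by
    intro n
    induction n with
    | zero => simp [qFact]
    | succ n ih =>
      have hle : (qNat q (n + 1))⁻¹ ≤ Real.exp (|q| ^ n / (1 - |q|)) * (1 - q) := by
        have hp := one_sub_pow_succ_pos hq n
        have e : (qNat q (n + 1))⁻¹ = (1 - q ^ (n + 1))⁻¹ * (1 - q) := by
          rw [← one_sub_mul_qNat]
          field_simp
        rw [e]
        refine mul_le_mul_of_nonneg_right ?_ h1q.le
        refine le_trans ?_ (Real.add_one_le_exp _)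
        have hpow : q ^ (n + 1) ≤ |q| ^ n * |q| := by
          rw [← pow_succ, ← abs_pow]; exact le_abs_self _
        have hn0 : 0 ≤ |q| ^ n := by positivity
        have hn1 : |q| ^ n ≤ 1 := pow_le_one₀ (abs_nonneg _) hq.le
        have hle1 : |q| ^ n * |q| ≤ |q| ^ n := by nlinarith [abs_nonneg q]
        have hle2 : |q| ^ n * |q| ≤ |q| := by nlinarith [abs_nonneg q]
        rw [inv_le_iff_one_le_mul₀ hp]
        have hb : 1 - |q| ^ n * |q| ≤ 1 - q ^ (n + 1) := by linarith
        refine le_trans ?_ (mul_le_mul_of_nonneg_left hb (by positivity))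
        rw [div_add_one h1.ne', div_mul_eq_mul_div, le_div_iff₀ h1]
        nlinarith [mul_nonneg hn0 (sub_nonneg.mpr hle2)]
      rw [qFact, mul_inv, Finset.sum_range_succ, Real.exp_add, pow_succ]
      calc (qFact q n)⁻¹ * (qNat q (n + 1))⁻¹
          ≤ (Real.exp (∑ j ∈ Finset.range n, |q| ^ j / (1 - |q|)) * (1 - q) ^ n) *
            (Real.exp (|q| ^ n / (1 - |q|)) * (1 - q)) :=
            mul_le_mul ih hle (inv_pos.mpr (qNat_succ_pos hq n)).le (by positivity)
        _ = _ := by ring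
  refine ⟨Real.exp (∑' j, |q| ^ j / (1 - |q|)), Real.exp_pos _, fun n => (key n).trans ?_⟩
  have hs : Summable fun j : ℕ => |q| ^ j / (1 - |q|) :=
    (summable_geometric_of_lt_one (abs_nonneg _) hq).div_const _
  gcongr
  exact hs.sum_le_tsum _ fun j _ => by positivity

end qIntegers

section qHermite

variable {q x : ℝ}

lemma qHermite_succ (q x : ℝ) (n : ℕ) :
    qHermite q (n + 1) x = x * qHermite q n x - qNat q n * qHermite q (n - 1) x := by
  cases n with
  | zero => simp [qHermite, qNat]
  | succ n => simp [qHermite]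

lemma exists_norm_eq_one_of_mem_Sq (hq : |q| < 1) (hx : x ∈ Sq q) :
    ∃ e : ℂ, ‖e‖ = 1 ∧ ((Real.sqrt (1 - q) * x : ℝ) : ℂ) = e + e⁻¹ := by
  have hc : 0 < Real.sqrt (1 - q) := Real.sqrt_pos.mpr (one_sub_pos_of_abs_lt_one hq)
  set c := Real.sqrt (1 - q)
  obtain ⟨h1, h2⟩ := hx
  have h2' : c * x ≤ 2 := by rw [le_div_iff₀ hc] at h2; linarith
  have h1' : -2 ≤ c * x := by
    have : -x ≤ 2 / c := by linarith
    rw [le_div_iff₀ hc] at this; linarith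
  refine ⟨Complex.exp (Real.arccos (c * x / 2) * Complex.I), Complex.norm_exp_ofReal_mul_I _, ?_⟩
  rw [← Complex.exp_neg, ← neg_mul, ← Complex.two_cos, ← Complex.ofReal_cos,
    Real.cos_arccos (by linarith) (by linarith)]
  push_cast
  ring

/-- On `S(q)` the polynomial `H_n(x|q)` is at most of size `n (1 - q)^{-n/2}`. -/
lemma exists_abs_qHermite_le (hq : |q| < 1) (hx : x ∈ Sq q) :
    ∃ A : ℝ, 0 < A ∧ ∀ n : ℕ, |qHermite q n x| * Real.sqrt (1 - q) ^ n ≤ A * (n + 1) := by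
  obtain ⟨e, he, hxe⟩ := exists_norm_eq_one_of_mem_Sq hq hx
  have h1q := one_sub_pos_of_abs_lt_one hq
  have hc2 : Real.sqrt (1 - q) ^ 2 = 1 - q := Real.sq_sqrt h1q.le
  have hc : 0 < Real.sqrt (1 - q) := Real.sqrt_pos.mpr h1q
  set c := Real.sqrt (1 - q)
  have he0 : e ≠ 0 := by rintro rfl; simp at he
  set h : ℕ → ℝ := fun n => c ^ n * qHermite q n x with hh
  have hrec : ∀ n, h (n + 2) = (c * x) * h (n + 1) - (1 - q ^ (n + 1)) * h n := by
    intro n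
    simp only [hh, ← one_sub_mul_qNat, ← hc2, qHermite]
    ring
  set g : ℕ → ℝ := fun n => ∏ k ∈ Finset.range n, (1 + (k + 1) * |q| ^ (k + 1)) with hg
  have hgs : ∀ n, g (n + 1) = g n * (1 + (n + 1) * |q| ^ (n + 1)) := fun n =>
    Finset.prod_range_succ _ _
  have hg0 : ∀ n, 0 < g n := fun n => Finset.prod_pos fun k _ => by positivity
  have key : ∀ n : ℕ, |h n| ≤ (n + 1) * g n ∧ ‖(h (n + 1) : ℂ) - e * h n‖ ≤ g n := by
    intro n
    induction n with
    | zero =>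
      have : ((h 1 : ℝ) : ℂ) - e * (h 0 : ℝ) = e⁻¹ := by
        simp only [hh, qHermite, pow_one, hxe]
        simp
      refine ⟨by simp [hh, hg, qHermite], ?_⟩
      rw [zero_add, this]
      simp [hg, he]
    | succ n ih =>
      obtain ⟨i1, i2⟩ := ih
      have hmono : g n ≤ g (n + 1) := by
        rw [hgs]
        exact le_mul_of_one_le_right (hg0 n).le (le_add_of_nonneg_right (by positivity))
      constructor
      · have e1 : ((h (n + 1) : ℝ) : ℂ) = (h (n + 1) - e * h n) + e * h n := by ring
        have : |h (n + 1)| ≤ g n + |h n| := by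
          calc |h (n + 1)| = ‖((h (n + 1) : ℝ) : ℂ)‖ := by simp
            _ ≤ ‖(h (n + 1) : ℂ) - e * h n‖ + ‖e * (h n : ℂ)‖ := by
              conv_lhs => rw [e1]
              exact norm_add_le _ _
            _ ≤ g n + |h n| := by
              rw [norm_mul, he, one_mul, Complex.norm_real, Real.norm_eq_abs]
              gcongr
        push_cast
        calc |h (n + 1)| ≤ (n + 1 + 1) * g n := by linarith
          _ ≤ _ := by gcongr
      · have e2 : ((h (n + 2) : ℝ) : ℂ) - e * h (n + 1) =
            e⁻¹ * (h (n + 1) - e * h n) + (q : ℂ) ^ (n + 1) * h n := by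
          rw [hrec]
          push_cast
          push_cast at hxe
          rw [hxe]
          field_simp
          ring
        rw [e2, hgs]
        calc _ ≤ ‖e⁻¹ * ((h (n + 1) : ℂ) - e * h n)‖ + ‖(q : ℂ) ^ (n + 1) * h n‖ := norm_add_le _ _
          _ ≤ g n + |q| ^ (n + 1) * ((n + 1) * g n) := by
            rw [norm_mul, norm_inv, he, inv_one, one_mul, norm_mul, norm_pow, Complex.norm_real,
              Complex.norm_real, Real.norm_eq_abs, Real.norm_eq_abs]
            gcongr
          _ = _ := by ring
  have hs : Summable fun k : ℕ => ((k : ℝ) + 1) * |q| ^ (k + 1) := by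
    have := (summable_nat_add_iff 1).mpr
      (summable_pow_mul_geometric_of_norm_lt_one 1 (r := |q|) (by simpa using hq))
    simpa using this
  refine ⟨Real.exp (∑' k : ℕ, ((k : ℝ) + 1) * |q| ^ (k + 1)), Real.exp_pos _, fun n => ?_⟩
  have hgb : g n ≤ Real.exp (∑' k : ℕ, ((k : ℝ) + 1) * |q| ^ (k + 1)) := by
    calc g n ≤ ∏ k ∈ Finset.range n, Real.exp (((k : ℝ) + 1) * |q| ^ (k + 1)) :=
          Finset.prod_le_prod (fun k _ => by positivity)
            fun k _ => by rw [add_comm]; exact Real.add_one_le_exp _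
      _ ≤ _ := by
        rw [← Real.exp_sum]
        exact Real.exp_le_exp.mpr (hs.sum_le_tsum _ fun j _ => by positivity)
  calc |qHermite q n x| * c ^ n = |h n| := by
        simp only [hh]; rw [abs_mul, abs_pow, abs_of_pos hc, mul_comm]
    _ ≤ (n + 1) * g n := (key n).1
    _ ≤ _ := by rw [mul_comm]; gcongr

lemma exists_abs_qHermite_add_le (hq : |q| < 1) (hx : x ∈ Sq q) :
    ∃ A : ℝ, 0 < A ∧ ∀ n k : ℕ, |qHermite q (n + k) x| ≤
      A * ((n + 1) / Real.sqrt (1 - q) ^ n) * ((k + 1) / Real.sqrt (1 - q) ^ k) := by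
  obtain ⟨A, hA, h⟩ := exists_abs_qHermite_le hq hx
  have hc : 0 < Real.sqrt (1 - q) := Real.sqrt_pos.mpr (one_sub_pos_of_abs_lt_one hq)
  refine ⟨A, hA, fun n k => ?_⟩
  have h' := h (n + k)
  rw [← le_div_iff₀ (by positivity)] at h'
  refine h'.trans ?_
  rw [mul_assoc, div_mul_div_comm, ← pow_add, mul_div_assoc]
  gcongr
  push_cast
  nlinarith [mul_nonneg (Nat.cast_nonneg (α := ℝ) n) (Nat.cast_nonneg (α := ℝ) k)]

lemma summable_add_one_pow_mul_geometric (d : ℕ) {r : ℝ} (hr : |r| < 1) :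
    Summable fun n : ℕ => ((n : ℝ) + 1) ^ d * |r| ^ n := by
  by_cases h0 : r = 0
  · subst h0
    refine summable_of_ne_finset_zero (s := {0}) fun n hn => ?_
    simp at hn
    simp [hn]
  · have := (summable_nat_add_iff 1).mpr
      (summable_pow_mul_geometric_of_norm_lt_one d (r := |r|) (by simpa using hr))
    refine (this.div_const |r|).congr fun n => ?_
    have : |r| ≠ 0 := by simpa using h0
    push_cast
    rw [pow_succ]
    field_simp

end qHermite

section series

variable {q x y t s ρ : ℝ}

/-- A shift of the summation index against the weights `tⁿ / [n]_q!`. -/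
lemma hasSum_qNat_mul_shift (hq : |q| < 1) {f : ℕ → ℝ} {a : ℝ}
    (hf : HasSum (fun n => t ^ n / qFact q n * f (n + 1)) a) :
    HasSum (fun n => t ^ n / qFact q n * (qNat q n * f n)) (t * a) := by
  rw [← hasSum_nat_add_iff' 1]
  simp only [Finset.sum_range_one, qNat, Finset.range_zero, Finset.sum_empty, zero_mul, mul_zero,
    sub_zero]
  refine (hf.mul_left t).congr_fun ?_
  intro n
  have h1 := (qFact_pos hq n).ne'
  have h2 := (qNat_succ_pos hq n).ne'
  change t ^ (n + 1) / qFact q (n + 1) * (qNat q (n + 1) * f (n + 1)) = _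
  rw [qFact]
  field_simp
  ring

lemma exists_abs_triple_le (hq : |q| < 1) (hx : x ∈ Sq q) (hy : y ∈ Sq q) (ρ : ℝ) :
    ∃ C : ℝ, ∀ k i j : ℕ,
      |ρ ^ k / qFact q k * qHermite q (k + i) x * qHermite q (k + j) y| ≤
        C * ((k + 1) ^ 2 * |ρ| ^ k) * ((i + 1) / Real.sqrt (1 - q) ^ i) *
          ((j + 1) / Real.sqrt (1 - q) ^ j) := by
  obtain ⟨B, hB, hb⟩ := exists_inv_qFact_le hq
  obtain ⟨A, hA, ha⟩ := exists_abs_qHermite_add_le hq hx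
  obtain ⟨A', hA', ha'⟩ := exists_abs_qHermite_add_le hq hy
  have h1q := one_sub_pos_of_abs_lt_one hq
  have hc2 : Real.sqrt (1 - q) ^ 2 = 1 - q := Real.sq_sqrt h1q.le
  have hc : 0 < Real.sqrt (1 - q) := Real.sqrt_pos.mpr h1q
  set c := Real.sqrt (1 - q)
  refine ⟨B * A * A', fun k i j => ?_⟩
  have hb' := hb k
  rw [← hc2] at hb'
  rw [abs_mul, abs_mul, abs_div, abs_pow, abs_of_pos (qFact_pos hq k), div_eq_mul_inv]
  have := (inv_pos.mpr (qFact_pos hq k)).le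
  calc _ ≤ |ρ| ^ k * (B * (c ^ 2) ^ k) * (A * ((k + 1) / c ^ k) * ((i + 1) / c ^ i)) *
        (A' * ((k + 1) / c ^ k) * ((j + 1) / c ^ j)) := by
        gcongr
        · exact ha k i
        · exact ha' k j
    _ = _ := by
        rw [← pow_mul, mul_comm 2 k, pow_mul]
        field_simp

lemma summable_gammaPM (hq : |q| < 1) (hρ : |ρ| < 1) (hx : x ∈ Sq q) (hy : y ∈ Sq q) (i j : ℕ) :
    Summable fun n => ρ ^ n / qFact q n * qHermite q (n + i) x * qHermite q (n + j) y := by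
  obtain ⟨C, hC⟩ := exists_abs_triple_le hq hx hy ρ
  refine Summable.of_norm_bounded ?_ fun n => hC n i j
  exact (((summable_add_one_pow_mul_geometric 2 hρ).mul_left C).mul_right _).mul_right _

/-- The general term of `∑ tⁿ H_{n+k}(x|q) / [n]_q!`, bounded uniformly in `n` and `k`. -/
lemma exists_abs_shifted_phiH_term_le (hq : |q| < 1) (hx : x ∈ Sq q) (t : ℝ) :
    ∃ C : ℝ, ∀ n k : ℕ, |t ^ n / qFact q n * qHermite q (n + k) x| ≤
      C * ((n + 1) ^ 1 * |t * Real.sqrt (1 - q)| ^ n) * ((k + 1) / Real.sqrt (1 - q) ^ k) := by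
  obtain ⟨B, hB, hb⟩ := exists_inv_qFact_le hq
  obtain ⟨A, hA, ha⟩ := exists_abs_qHermite_add_le hq hx
  have h1q := one_sub_pos_of_abs_lt_one hq
  have hc2 : Real.sqrt (1 - q) ^ 2 = 1 - q := Real.sq_sqrt h1q.le
  have hc : 0 < Real.sqrt (1 - q) := Real.sqrt_pos.mpr h1q
  set c := Real.sqrt (1 - q)
  refine ⟨B * A, fun n k => ?_⟩
  have hb' := hb n
  rw [← hc2] at hb'
  rw [abs_mul, abs_div, abs_pow, abs_of_pos (qFact_pos hq n), div_eq_mul_inv, abs_mul t,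
    abs_of_pos hc, mul_pow]
  have := (inv_pos.mpr (qFact_pos hq n)).le
  calc _ ≤ |t| ^ n * (B * (c ^ 2) ^ n) * (A * ((n + 1) / c ^ n) * ((k + 1) / c ^ k)) := by
        gcongr
        exact ha n k
    _ = _ := by
        rw [← pow_mul, mul_comm 2 n, pow_mul]
        field_simp

lemma summable_shifted_phiH (hq : |q| < 1) (hx : x ∈ Sq q)
    (ht : |t| * Real.sqrt (1 - q) < 1) (k : ℕ) :
    Summable fun n => t ^ n / qFact q n * qHermite q (n + k) x := by
  obtain ⟨C, hC⟩ := exists_abs_shifted_phiH_term_le hq hx t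
  refine Summable.of_norm_bounded ?_ fun n => hC n k
  refine ((summable_add_one_pow_mul_geometric 1 ?_).mul_left C).mul_right _
  rwa [abs_mul, abs_of_nonneg (Real.sqrt_nonneg _)]

lemma tsum_shifted_phiH_succ (hq : |q| < 1) (hx : x ∈ Sq q)
    (ht : |t| * Real.sqrt (1 - q) < 1) (k : ℕ) :
    ∑' n, t ^ n / qFact q n * qHermite q (n + (k + 1)) x =
      (x - t * q ^ k) * ∑' n, t ^ n / qFact q n * qHermite q (n + k) x -
        qNat q k * ∑' n, t ^ n / qFact q n * qHermite q (n + (k - 1)) x := by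
  have hk := (summable_shifted_phiH hq hx ht k).hasSum
  have hk1 := (summable_shifted_phiH hq hx ht (k - 1)).hasSum
  have hshift := hasSum_qNat_mul_shift (t := t) (f := fun n => qHermite q (n + k - 1) x) hq
    (hk.congr_fun fun n => by simp [show n + 1 + k - 1 = n + k by omega])
  have h := ((hk.mul_left x).sub (hk1.mul_left (qNat q k))).sub (hshift.mul_left (q ^ k))
  refine Eq.trans (HasSum.tsum_eq (h.congr_fun fun n => ?_)) (by ring)
  rw [← add_assoc, qHermite_succ, add_comm n k, qNat_add]
  cases k with
  | zero => simp [qNat]; ring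
  | succ k =>
    simp only [show k + 1 + n - 1 = n + k by omega, show n + (k + 1 - 1) = n + k by omega]
    ring

lemma tsum_shifted_phiH (hq : |q| < 1) (hx : x ∈ Sq q) (ht : |t| * Real.sqrt (1 - q) < 1) (k : ℕ) :
    ∑' n, t ^ n / qFact q n * qHermite q (n + k) x = phiH q t x * bigqHermite q t k x := by
  induction k using Nat.twoStepInduction with
  | zero => simp [phiH, bigqHermite]
  | one =>
    rw [tsum_shifted_phiH_succ hq hx ht 0]
    simp [phiH, bigqHermite, qNat]
    ring
  | more k ih1 ih2 =>
    rw [tsum_shifted_phiH_succ hq hx ht (k + 1), Nat.add_sub_cancel, ih1, ih2, bigqHermite]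
    ring

lemma gammaPM_comm (q ρ : ℝ) (i j : ℕ) (x y : ℝ) : gammaPM q ρ i j x y = gammaPM q ρ j i y x :=
  tsum_congr fun n => by ring

lemma gammaPM_succ_left (hq : |q| < 1) (hρ : |ρ| < 1) (hx : x ∈ Sq q) (hy : y ∈ Sq q) (i j : ℕ) :
    gammaPM q ρ (i + 1) j x y = x * gammaPM q ρ i j x y - qNat q i * gammaPM q ρ (i - 1) j x y -
      q ^ i * ρ * gammaPM q ρ i (j + 1) x y := by
  have h0 := (summable_gammaPM hq hρ hx hy i j).hasSum
  have h1 := (summable_gammaPM hq hρ hx hy (i - 1) j).hasSum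
  have h2 := (summable_gammaPM hq hρ hx hy i (j + 1)).hasSum
  have hshift := hasSum_qNat_mul_shift (t := ρ)
    (f := fun n => qHermite q (n + i - 1) x * qHermite q (n + j) y) hq
    (h2.congr_fun fun n => by
      simp [show n + 1 + i - 1 = n + i by omega, show n + 1 + j = n + (j + 1) by omega, mul_assoc])
  have h := ((h0.mul_left x).sub (h1.mul_left (qNat q i))).sub (hshift.mul_left (q ^ i))
  refine Eq.trans (HasSum.tsum_eq (h.congr_fun fun n => ?_)) (by simp only [gammaPM]; ring)
  rw [← add_assoc, qHermite_succ, add_comm n i, qNat_add]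
  cases i with
  | zero => simp [qNat]; ring
  | succ k =>
    simp only [show k + 1 + n - 1 = n + k by omega, show n + (k + 1 - 1) = n + k by omega]
    ring

lemma gammaPM_succ_right (hq : |q| < 1) (hρ : |ρ| < 1) (hx : x ∈ Sq q) (hy : y ∈ Sq q) (i j : ℕ) :
    gammaPM q ρ i (j + 1) x y = y * gammaPM q ρ i j x y - qNat q j * gammaPM q ρ i (j - 1) x y -
      q ^ j * ρ * gammaPM q ρ (i + 1) j x y := by
  rw [gammaPM_comm, gammaPM_succ_left hq hρ hy hx]
  simp only [gammaPM_comm q ρ _ _ y x]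

end series

section Carlitz

variable {q x y ρ : ℝ}

lemma gammaPM_zero_right (hq : |q| < 1) (hρ : |ρ| < 1) (hx : x ∈ Sq q) (hy : y ∈ Sq q) (i : ℕ) :
    gammaPM q ρ i 0 x y = ascP q y ρ i x / qPoch (ρ ^ 2) q i * gammaPM q ρ 0 0 x y := by
  have hp := qPoch_ne_zero hq hρ
  have hps : ∀ n, qPoch (ρ ^ 2) q (n + 1) = qPoch (ρ ^ 2) q n * (1 - ρ ^ 2 * q ^ n) := fun n =>
    Finset.prod_range_succ _ _
  have hne : ∀ n, 1 - ρ ^ 2 * q ^ n ≠ 0 := fun n => right_ne_zero_of_mul (hps n ▸ hp (n + 1))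
  have hrec : ∀ n, (1 - ρ ^ 2 * q ^ n) * gammaPM q ρ (n + 1) 0 x y =
      (x - ρ * y * q ^ n) * gammaPM q ρ n 0 x y - qNat q n * gammaPM q ρ (n - 1) 0 x y := by
    intro n
    have h1 := gammaPM_succ_left hq hρ hx hy n 0
    have h2 := gammaPM_succ_right hq hρ hx hy n 0
    simp only [qNat, Finset.range_zero, Finset.sum_empty, zero_mul, pow_zero, sub_zero,
      one_mul] at h2
    rw [h2] at h1
    linear_combination h1
  induction i using Nat.twoStepInduction with
  | zero => simp [ascP, qPoch]
  | one =>
    have h := hrec 0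
    simp only [qNat, Finset.range_zero, Finset.sum_empty, zero_mul, pow_zero, sub_zero,
      mul_one] at h
    have h0 := hne 0
    rw [pow_zero, mul_one] at h0
    simp only [ascP, qPoch, Finset.prod_range_one, pow_zero, mul_one]
    rw [div_mul_eq_mul_div, eq_div_iff h0]
    linear_combination h
  | more i ih1 ih2 =>
    have h := hrec (i + 1)
    rw [Nat.add_sub_cancel, ih1, ih2] at h
    refine mul_left_cancel₀ (hne (i + 1)) (h.trans ?_)
    rw [hps (i + 1), hps i, ascP]
    have a1 := hp i
    have a2 := hne i
    have a3 := hne (i + 1)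
    field_simp

/-- The coefficients of `Q_{i,j}` in its expansion in Al-Salam--Chihara polynomials. -/
def qCoeff (q ρ y : ℝ) (j s : ℕ) : ℝ :=
  (-1 : ℝ) ^ s * q ^ (s * (s - 1) / 2) * qBinom q j s * ρ ^ s * qHermite q (j - s) y

lemma qCoeff_of_lt {j s : ℕ} (h : j < s) : qCoeff q ρ y j s = 0 := by
  simp [qCoeff, qBinom, h]

lemma qCoeff_zero_right (hq : |q| < 1) (j : ℕ) : qCoeff q ρ y j 0 = qHermite q j y := by
  simp [qCoeff, qBinom, qFact, div_self (qFact_pos hq j).ne']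

lemma qBinom_add (q : ℝ) (d s : ℕ) :
    qBinom q (d + s) s = qFact q (d + s) / (qFact q d * qFact q s) := by
  simp [qBinom]

lemma qCoeff_add (q ρ y : ℝ) (d s : ℕ) : qCoeff q ρ y (d + s) s =
    (-1 : ℝ) ^ s * q ^ (s * (s - 1) / 2) * (qFact q (d + s) / (qFact q d * qFact q s)) * ρ ^ s *
      qHermite q d y := by
  simp [qCoeff, qBinom_add]

lemma qCoeff_rec (hq : |q| < 1) (j s : ℕ) :
    qCoeff q ρ y (j + 1) (s + 1) = y * qCoeff q ρ y j (s + 1) -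
      qNat q j * qCoeff q ρ y (j - 1) (s + 1) - q ^ j * ρ * qCoeff q ρ y j s := by
  have hf := fun n => (qFact_pos hq n).ne'
  have hn := fun n => (qNat_succ_pos hq n).ne'
  have htri : (s + 1) * (s + 1 - 1) / 2 = s * (s - 1) / 2 + s := Nat.triangle_succ s
  rcases lt_or_ge j s with h | h
  · simp [qCoeff_of_lt (show j + 1 < s + 1 by omega), qCoeff_of_lt (show j < s + 1 by omega),
      qCoeff_of_lt (show j - 1 < s + 1 by omega), qCoeff_of_lt h]
  · obtain ⟨d, rfl⟩ := Nat.exists_eq_add_of_le' h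
    rw [show d + s + 1 = d + (s + 1) by omega, qCoeff_add, qCoeff_add, htri]
    have h1 := hf s
    have h2 := hn s
    rcases d with _ | _ | d
    · rw [qCoeff_of_lt (by omega), qCoeff_of_lt (by omega), show 0 + (s + 1) = s + 1 by omega]
      simp only [qHermite, zero_add, qFact, pow_add, pow_one]
      field_simp
      ring
    · have h3 := hn 0
      have h4 := qNat_add q 1 (s + 1)
      rw [show 0 + 1 + s = 0 + (s + 1) by omega, qCoeff_add, qCoeff_of_lt (by omega), htri,
        show 0 + 1 + (s + 1) = s + 1 + 1 by omega, show 0 + (s + 1) = s + 1 by omega]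
      rw [show 1 + (s + 1) = s + 1 + 1 by omega] at h4
      simp only [qHermite, zero_add, qFact, pow_add, pow_one, h4] at h3 ⊢
      field_simp
      ring
    · have h3 := hf d
      have h4 := hn d
      have h5 := hn (d + 1)
      have h6 := qNat_add q (d + 2) (s + 1)
      rw [show d + 2 + (s + 1) = d + s + 1 + 1 + 1 by omega] at h6
      rw [show d + 1 + 1 + s - 1 = d + (s + 1) by omega, qCoeff_add,
        show d + 1 + 1 + s = d + 1 + (s + 1) by omega, qCoeff_add, htri,
        show d + 1 + 1 + (s + 1) = d + s + 1 + 1 + 1 by omega,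
        show d + 1 + (s + 1) = d + s + 1 + 1 by omega, show d + (s + 1) = d + s + 1 by omega,
        show q ^ (d + s + 1 + 1) = q ^ (d + 2) * q ^ s by ring,
        show q ^ (s * (s - 1) / 2 + s) = q ^ (s * (s - 1) / 2) * q ^ s from pow_add ..]
      simp only [qHermite, qFact, h6, pow_succ _ s]
      clear htri h h6
      generalize q ^ (d + 2) = Q, q ^ s = R, q ^ (s * (s - 1) / 2) = T, qFact q s = S,
        qFact q d = D, qFact q (d + s) = F, qNat q (s + 1) = u, qNat q (d + 1) = v,
        qNat q (d + 2) = w, qNat q (d + s + 1) = a, qNat q (d + s + 1 + 1) = b,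
        (-1 : ℝ) ^ s = m, ρ ^ s = r, qHermite q d y = H₀, qHermite q (d + 1) y = H₁ at *
      field_simp
      ring

lemma Qpoly_eq_sum (q ρ : ℝ) (i j : ℕ) (x y : ℝ) {N : ℕ} (hN : j + 1 ≤ N) :
    Qpoly q ρ i j x y = ∑ s ∈ Finset.range N,
      qCoeff q ρ y j s * (ascP q y ρ (i + s) x / qPoch (ρ ^ 2) q (i + s)) := by
  rw [Qpoly, ← Finset.sum_subset (Finset.range_subset_range.mpr hN)]
  · exact Finset.sum_congr rfl fun s _ => by rw [qCoeff, mul_div_assoc]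
  · intro s _ hs
    rw [qCoeff_of_lt (by simpa using hs), zero_mul]

lemma Qpoly_zero_right (hq : |q| < 1) (ρ : ℝ) (i : ℕ) (x y : ℝ) :
    Qpoly q ρ i 0 x y = ascP q y ρ i x / qPoch (ρ ^ 2) q i := by
  rw [Qpoly_eq_sum q ρ i 0 x y le_rfl]
  simp [qCoeff_zero_right hq, qHermite]

lemma Qpoly_succ_right (hq : |q| < 1) (ρ : ℝ) (i j : ℕ) (x y : ℝ) :
    Qpoly q ρ i (j + 1) x y = y * Qpoly q ρ i j x y - qNat q j * Qpoly q ρ i (j - 1) x y -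
      q ^ j * ρ * Qpoly q ρ (i + 1) j x y := by
  rw [Qpoly_eq_sum q ρ i (j + 1) x y (le_refl (j + 2)),
    Qpoly_eq_sum q ρ i j x y (show j + 1 ≤ j + 2 by omega),
    Qpoly_eq_sum q ρ i (j - 1) x y (show j - 1 + 1 ≤ j + 2 by omega),
    Qpoly_eq_sum q ρ (i + 1) j x y (le_refl (j + 1)), Finset.sum_range_succ' _ (j + 1),
    Finset.sum_range_succ' _ (j + 1), Finset.sum_range_succ' _ (j + 1), qCoeff_zero_right hq,
    qCoeff_zero_right hq, qCoeff_zero_right hq, qHermite_succ]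
  simp only [qCoeff_rec hq, sub_mul, Finset.sum_sub_distrib, mul_add, Finset.mul_sum,
    show ∀ s, i + 1 + s = i + (s + 1) by intro s; omega, mul_assoc]
  ring

/-- The formula of Carlitz expressing `γ_{i,j}` through `γ_{0,0}`. -/
lemma gammaPM_eq_Qpoly_mul (hq : |q| < 1) (hρ : |ρ| < 1) (hx : x ∈ Sq q) (hy : y ∈ Sq q)
    (i j : ℕ) : gammaPM q ρ i j x y = Qpoly q ρ i j x y * gammaPM q ρ 0 0 x y := by
  induction j using Nat.strong_induction_on generalizing i with
  | _ j ih =>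
    cases j with
    | zero => rw [Qpoly_zero_right hq, gammaPM_zero_right hq hρ hx hy]
    | succ j =>
      rw [gammaPM_succ_right hq hρ hx hy, Qpoly_succ_right hq, ih j (by omega) i,
        ih (j - 1) (by omega) i, ih j (by omega) (i + 1)]
      ring

lemma gammaPM_mul_q (hq : |q| < 1) (hρ : |ρ| < 1) (hx : x ∈ Sq q) (hy : y ∈ Sq q) :
    gammaPM q (ρ * q) 0 0 x y = gammaPM q ρ 0 0 x y - (1 - q) * (ρ * gammaPM q ρ 1 1 x y) := by
  have h0 := (summable_gammaPM hq hρ hx hy 0 0).hasSum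
  have h1 := (summable_gammaPM hq hρ hx hy 1 1).hasSum
  have hshift := hasSum_qNat_mul_shift (t := ρ) (f := fun n => qHermite q n x * qHermite q n y) hq
    (h1.congr_fun fun n => by simp [mul_assoc])
  refine HasSum.tsum_eq ((h0.sub (hshift.mul_left (1 - q))).congr_fun fun n => ?_)
  have := one_sub_mul_qNat q n
  simp only [add_zero, mul_pow]
  rw [show q ^ n = 1 - (1 - q) * qNat q n by linarith]
  ring

lemma tendsto_gammaPM_mul_pow (hq : |q| < 1) (hρ : |ρ| < 1) (hx : x ∈ Sq q) (hy : y ∈ Sq q) :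
    Filter.Tendsto (fun n : ℕ => gammaPM q (ρ * q ^ n) 0 0 x y) Filter.atTop (nhds 1) := by
  have hlim : ∑' k : ℕ, (if k = 0 then (1 : ℝ) else 0) = 1 := by simp
  rw [← hlim]
  refine tendsto_tsum_of_dominated_convergence (summable_gammaPM hq hρ hx hy 0 0).norm ?_ ?_
  · intro k
    cases k with
    | zero => simp [qFact, qHermite]
    | succ k =>
      have h := (tendsto_pow_atTop_nhds_zero_of_abs_lt_one hq).const_mul ρ
      have h' := ((((h.pow (k + 1)).div_const (qFact q (k + 1))).mul_const
        (qHermite q (k + 1 + 0) x)).mul_const (qHermite q (k + 1 + 0) y))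
      simpa using h'
  · refine Filter.Eventually.of_forall fun n k => ?_
    simp only [norm_mul, norm_div, norm_pow]
    have h1 : ‖ρ‖ * ‖q‖ ^ n ≤ ‖ρ‖ :=
      mul_le_of_le_one_right (norm_nonneg _) (pow_le_one₀ (norm_nonneg _) hq.le)
    gcongr

lemma gammaPM_ne_zero (hq : |q| < 1) (hρ : |ρ| < 1) (hx : x ∈ Sq q) (hy : y ∈ Sq q) :
    gammaPM q ρ 0 0 x y ≠ 0 := by
  intro h0
  have hall : ∀ n : ℕ, gammaPM q (ρ * q ^ n) 0 0 x y = 0 := by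
    intro n
    induction n with
    | zero => simpa using h0
    | succ n ih =>
      have hρn : |ρ * q ^ n| < 1 := by
        rw [abs_mul, abs_pow]
        exact mul_lt_one_of_nonneg_of_lt_one_left (abs_nonneg _) hρ
          (pow_le_one₀ (abs_nonneg _) hq.le)
      rw [pow_succ, ← mul_assoc, gammaPM_mul_q hq hρn hx hy,
        gammaPM_eq_Qpoly_mul hq hρn hx hy 1 1, ih]
      ring
  have h := tendsto_gammaPM_mul_pow hq hρ hx hy
  simp only [hall] at h
  exact zero_ne_one (tendsto_nhds_unique tendsto_const_nhds h)

end Carlitz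

lemma summable_triple {q x y t s ρ : ℝ} (hq : |q| < 1) (hρ : |ρ| < 1)
    (hx : x ∈ Sq q) (hy : y ∈ Sq q)
    (ht : |t| * Real.sqrt (1 - q) < 1) (hs : |s| * Real.sqrt (1 - q) < 1) :
    Summable fun r : (ℕ × ℕ) × ℕ => t ^ r.1.1 * s ^ r.1.2 / (qFact q r.1.1 * qFact q r.1.2) *
      (ρ ^ r.2 / qFact q r.2 * qHermite q (r.2 + r.1.1) x * qHermite q (r.2 + r.1.2) y) := by
  obtain ⟨B, hB, hb⟩ := exists_inv_qFact_le hq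
  obtain ⟨C, hC⟩ := exists_abs_triple_le hq hx hy ρ
  have h1q := one_sub_pos_of_abs_lt_one hq
  have hc2 : Real.sqrt (1 - q) ^ 2 = 1 - q := Real.sq_sqrt h1q.le
  have hc : 0 < Real.sqrt (1 - q) := Real.sqrt_pos.mpr h1q
  rw [← hc2] at hb
  have hgeom : ∀ {u : ℝ}, |u| * Real.sqrt (1 - q) < 1 →
      Summable fun n : ℕ => ((n : ℝ) + 1) ^ 1 * |u * Real.sqrt (1 - q)| ^ n := fun hu =>
    summable_add_one_pow_mul_geometric 1 (by rwa [abs_mul, abs_of_pos hc])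
  set c := Real.sqrt (1 - q)
  have hS := ((hgeom ht).mul_of_nonneg (hgeom hs) (fun n => by positivity)
    (fun n => by positivity)).mul_of_nonneg (summable_add_one_pow_mul_geometric 2 hρ)
    (fun n => by positivity) (fun n => by positivity)
  refine Summable.of_norm_bounded (hS.mul_left (B * B * C)) ?_
  rintro ⟨⟨n, m⟩, k⟩
  have hfn := (inv_pos.mpr (qFact_pos hq n)).le
  have hfm := (inv_pos.mpr (qFact_pos hq m)).le
  rw [norm_mul, Real.norm_eq_abs, Real.norm_eq_abs, div_eq_mul_inv, mul_inv, abs_mul, abs_mul,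
    abs_pow, abs_pow, abs_mul, abs_of_nonneg hfn, abs_of_nonneg hfm]
  dsimp only
  calc _ ≤ |t| ^ n * |s| ^ m * ((B * (c ^ 2) ^ n) * (B * (c ^ 2) ^ m)) *
        (C * ((k + 1) ^ 2 * |ρ| ^ k) * ((n + 1) / c ^ n) * ((m + 1) / c ^ m)) := by
        gcongr
        · exact hb n
        · exact hb m
        · exact hC k n m
    _ = _ := by
        rw [abs_mul, abs_mul, abs_of_pos hc, mul_pow, mul_pow, ← pow_mul, ← pow_mul, mul_comm 2 n,
          mul_comm 2 m, pow_mul, pow_mul]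
        field_simp

/-- the generating function of the polynomials Q_{n,m}. -/
theorem statement9 (q ρ x y t s : ℝ) (hq : |q| < 1) (hρ : |ρ| < 1)
    (hx : x ∈ Sq q) (hy : y ∈ Sq q)
    (ht : |t| * Real.sqrt (1 - q) < 1) (hs : |s| * Real.sqrt (1 - q) < 1) :
    (∑' p : ℕ × ℕ, t ^ p.1 * s ^ p.2 / (qFact q p.1 * qFact q p.2) *
        Qpoly q ρ p.1 p.2 x y) =
      phiH q t x * phiH q s y / gammaPM q ρ 0 0 x y *
        ∑' k : ℕ, ρ ^ k / qFact q k * bigqHermite q t k x * bigqHermite q s k y := by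
  have hγ := gammaPM_ne_zero hq hρ hx hy
  have hsum := summable_triple hq hρ hx hy ht hs
  rw [div_mul_eq_mul_div, eq_div_iff hγ, ← tsum_mul_right, ← tsum_mul_left]
  calc _ = ∑' p : ℕ × ℕ, ∑' k : ℕ, t ^ p.1 * s ^ p.2 / (qFact q p.1 * qFact q p.2) *
        (ρ ^ k / qFact q k * qHermite q (k + p.1) x * qHermite q (k + p.2) y) :=
        tsum_congr fun p => by
          rw [mul_assoc, ← gammaPM_eq_Qpoly_mul hq hρ hx hy, gammaPM, tsum_mul_left]
    _ = ∑' k : ℕ, ∑' p : ℕ × ℕ, t ^ p.1 * s ^ p.2 / (qFact q p.1 * qFact q p.2) *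
        (ρ ^ k / qFact q k * qHermite q (k + p.1) x * qHermite q (k + p.2) y) :=
        (Summable.tsum_comm (f := fun (p : ℕ × ℕ) (k : ℕ) =>
          t ^ p.1 * s ^ p.2 / (qFact q p.1 * qFact q p.2) *
            (ρ ^ k / qFact q k * qHermite q (k + p.1) x * qHermite q (k + p.2) y)) hsum).symm
    _ = _ := tsum_congr fun k => by
        have h := tsum_mul_tsum_of_summable_norm (summable_shifted_phiH hq hx ht k).norm
          (summable_shifted_phiH hq hy hs k).norm
        rw [tsum_shifted_phiH hq hx ht, tsum_shifted_phiH hq hy hs] at h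
        calc _ = ρ ^ k / qFact q k * ∑' p : ℕ × ℕ, t ^ p.1 / qFact q p.1 * qHermite q (p.1 + k) x *
              (s ^ p.2 / qFact q p.2 * qHermite q (p.2 + k) y) := by
              rw [← tsum_mul_left]
              refine tsum_congr fun p => ?_
              rw [add_comm k, add_comm k, mul_div_mul_comm]
              ring
          _ = _ := by rw [← h]; ring
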